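/- arXiv:2208.07854 — 2 statements merged into one kernel-verified Lean document; each statement's English description precedes it below -/
import Mathlib

section
/- Let (X,T) be a minimal Cantor system, and let A, B be nonempty disjoint clopen subsets of X such that μ(A) < μ(B) for every T-invariant Borel probability measure μ. Then there exists a continuous p : A → ℤ⁺ such that x ↦ T^{p(x)}(x) is a homeomorphism from A onto a clopen subset of B. -/
open Set Filter Topology MeasureTheory

/-- A minimal homeomorphism: every two-sided orbit is dense. -/
def IsMinimal {X : Type*} [TopologicalSpace X] (T : X ≃ₜ X) : Prop :=
  ∀ x : X, Dense (Set.range fun n : ℤ => (T.toEquiv ^ n) x)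

/-- First return time of `x` to the set `A` under the map `T`. -/
noncomputable def retTime {X : Type*} (T : X → X) (A : Set X) (x : X) : ℕ :=
  sInf {n : ℕ | 0 < n ∧ T^[n] x ∈ A}

/-- `f` is a `T`-coboundary (with continuous transfer function). -/
def IsCob {X : Type*} [TopologicalSpace X] (T : X → X) (f : X → ℤ) : Prop :=
  ∃ g : X → ℤ, Continuous g ∧ ∀ x, f x = g x - g (T x)

/-- `[f]` is a nonzero positive class in `G(X,T) = C(X,ℤ)/∂_T`. -/
def PosClass {X : Type*} [TopologicalSpace X] (T : X → X) (f : X → ℤ) : Prop :=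
  ∃ u : X → ℤ, Continuous u ∧ (∀ x, 0 ≤ u x) ∧ (∃ x, u x ≠ 0) ∧
    IsCob T (fun x => f x - u x)

/-- The indicator function of a set, with values in `ℤ`. -/
noncomputable def ind {X : Type*} (A : Set X) : X → ℤ := A.indicator fun _ => 1

/-- `[f]` is a nonzero positive class in `G(X,T)/Inf`: `f` is a nonnegative nonzero
continuous function plus a function integrating to zero against every invariant measure. -/
def PosClassInf {X : Type*} [TopologicalSpace X] [MeasurableSpace X]
    (T : X → X) (f : X → ℤ) : Prop :=
  ∃ u k : X → ℤ, Continuous u ∧ (∀ x, 0 ≤ u x) ∧ (∃ x, u x ≠ 0) ∧ Continuous k ∧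
    (∀ μ : Measure X, IsProbabilityMeasure μ → Measure.map T μ = μ →
      ∫ x, (k x : ℝ) ∂μ = 0) ∧
    (∀ x, f x = u x + k x)

/-- Krylov–Bogolyubov along a single orbit. -/
theorem exists_inv_measure {X : Type*} [MetricSpace X] [CompactSpace X]
    [MeasurableSpace X] [BorelSpace X] (T : X ≃ₜ X) (x : X) :
    ∃ μ : Measure X, IsProbabilityMeasure μ ∧ Measure.map (⇑T) μ = μ ∧
      ∀ g : BoundedContinuousFunction X ℝ, (∀ n, 0 ≤ birkhoffSum T g n x) → 0 ≤ ∫ y, g y ∂μ := by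
  let m : ℕ → Measure X := fun n =>
    ((n + 1 : ℕ) : ENNReal)⁻¹ • ∑ i ∈ Finset.range (n + 1), Measure.dirac (T^[i] x)
  have hm : ∀ n, IsProbabilityMeasure (m n) := by
    intro n
    constructor
    simp only [m, Measure.smul_apply, Measure.finsetSum_apply, measure_univ, smul_eq_mul,
      Finset.sum_const, Finset.card_range, nsmul_eq_mul, mul_one]
    exact ENNReal.inv_mul_cancel (by simp) (by exact ENNReal.natCast_ne_top _)
  have hint : ∀ (g : BoundedContinuousFunction X ℝ) n,
      ∫ y, g y ∂(m n) = birkhoffAverage ℝ T g (n + 1) x := by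
    intro g n
    simp only [m]
    rw [integral_smul_measure, integral_finsetSum_measure]
    · rw [ENNReal.toReal_inv, ENNReal.toReal_natCast]
      simp [birkhoffAverage, birkhoffSum]
    · intro i _
      exact g.integrable _
  let P : ℕ → ProbabilityMeasure X := fun n => ⟨m n, hm n⟩
  let U : Ultrafilter ℕ := hyperfilter ℕ
  have hU : (U : Filter ℕ) ≤ atTop := Nat.hyperfilter_le_atTop
  obtain ⟨μ, -, hμ⟩ := isCompact_univ.ultrafilter_le_nhds (U.map P) (by simp)
  have hlim : Tendsto P U (𝓝 μ) := hμ
  rw [ProbabilityMeasure.tendsto_iff_forall_integral_tendsto] at hlim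
  have hlim' : ∀ g : BoundedContinuousFunction X ℝ,
      Tendsto (fun n => birkhoffAverage ℝ T g (n + 1) x) U (𝓝 (∫ y, g y ∂(μ : Measure X))) := by
    intro g
    refine (hlim g).congr fun n => hint g n
  refine ⟨μ, inferInstance, ?_, ?_⟩
  · have : IsProbabilityMeasure (Measure.map T (μ : Measure X)) :=
      Measure.isProbabilityMeasure_map T.continuous.measurable.aemeasurable
    refine ext_of_forall_integral_eq_of_IsFiniteMeasure fun g => ?_
    rw [integral_map T.continuous.measurable.aemeasurable
      g.continuous.aestronglyMeasurable]
    have h1 := hlim' (g.compContinuous ⟨T, T.continuous⟩)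
    have h2 := hlim' g
    have h3 := (tendsto_birkhoffAverage_apply_sub_birkhoffAverage' (𝕜 := ℝ)
      (g.isBounded_range) T x).comp (tendsto_add_atTop_nat 1)
    have h4 := tendsto_nhds_unique (h1.sub h2) ((h3.mono_left hU).congr fun n => by
      simp [birkhoffAverage, birkhoffSum, ← Function.iterate_succ_apply', Function.iterate_succ_apply])
    simpa [sub_eq_zero] using h4
  · intro g hg
    refine ge_of_tendsto' (hlim' g) fun n => ?_
    simp only [birkhoffAverage]
    have := hg (n + 1)
    rw [smul_eq_mul]
    positivity

/-- The open/close bracket weight. -/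
noncomputable def brk {X : Type*} (A B : Set X) (x : X) : ℤ := ind A x - ind B x

theorem continuous_ind {X : Type*} [TopologicalSpace X] {A : Set X} (hA : IsClopen A) :
    Continuous (ind A) := by
  unfold ind
  exact continuous_const.indicator (by simp [hA.frontier_eq])

theorem stmt13 {X : Type*} [MetricSpace X] [CompactSpace X] [PerfectSpace X]
    [TotallyDisconnectedSpace X] [MeasurableSpace X] [BorelSpace X]
    (T : X ≃ₜ X) (hmin : IsMinimal T)
    (A B : Set X) (hA : IsClopen A) (hB : IsClopen B)
    (hAne : A.Nonempty) (hBne : B.Nonempty) (hdisj : Disjoint A B)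
    (hlt : ∀ μ : Measure X, IsProbabilityMeasure μ → Measure.map (⇑T) μ = μ →
      μ A < μ B) :
    ∃ C : Set X, C ⊆ B ∧ IsClopen C ∧
      ∃ p : A → ℕ, Continuous p ∧ (∀ x, 0 < p x) ∧
        ∃ e : A ≃ₜ C, ∀ x : A, (e x : X) = (⇑T)^[p x] (x : X) := by
  classical
  let S : ℕ → X → ℤ := fun n x => birkhoffSum T (brk A B) n x
  have hfc : Continuous (brk A B) := (continuous_ind hA).sub (continuous_ind hB)
  have hTc : ∀ n, Continuous (T^[n]) := fun n => T.continuous.iterate n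
  have hSc : ∀ n, Continuous (S n) := fun n => by
    simp only [S, birkhoffSum]
    exact continuous_finsetSum _ fun i _ => hfc.comp (hTc i)
  have hS1 : ∀ x ∈ A, S 1 x = 1 := by
    intro x hx
    have : x ∉ B := fun h => hdisj.le_bot ⟨hx, h⟩
    simp [S, birkhoffSum, brk, ind, hx, this]
  have hex : ∀ x : A, ∃ n, 0 < n ∧ S (n + 1) x ≤ 0 := by
    rintro ⟨x, hx⟩
    by_contra! hcon
    obtain ⟨μ, hμ, hinv, hpos⟩ := exists_inv_measure T x
    have hc : Continuous (fun y => ((brk A B y : ℤ) : ℝ)) := continuous_of_discreteTopology.comp hfc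
    have h := hpos (BoundedContinuousFunction.mkOfCompact ⟨_, hc⟩) (by
      intro n
      have hn : 0 ≤ S n x := by
        rcases n with _ | _ | n
        · simp [S]
        · simp [hS1 x hx]
        · exact (hcon (n + 1) (by omega)).le
      have : ((S n x : ℤ) : ℝ) = birkhoffSum T (fun y => ((brk A B y : ℤ) : ℝ)) n x := by
        simp [S, birkhoffSum]
      have h2 : (0 : ℝ) ≤ ((S n x : ℤ) : ℝ) := by exact_mod_cast hn
      rw [this] at h2
      exact h2)
    have hlt' := hlt μ hμ hinv
    have heq : ∫ y, ((brk A B y : ℤ) : ℝ) ∂μ = μ.real A - μ.real B := by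
      have : ∀ y, ((brk A B y : ℤ) : ℝ) = A.indicator 1 y - B.indicator 1 y := by
        intro y
        by_cases h1 : y ∈ A <;> by_cases h2 : y ∈ B <;> simp [brk, ind, h1, h2]
      simp_rw [this]
      rw [integral_sub, integral_indicator_one hA.isOpen.measurableSet,
        integral_indicator_one hB.isOpen.measurableSet]
      · exact (integrable_const (1 : ℝ)).indicator hA.isOpen.measurableSet
      · exact (integrable_const (1 : ℝ)).indicator hB.isOpen.measurableSet
    have h' : 0 ≤ μ.real A - μ.real B := by rw [← heq]; exact h
    have : μ.real A < μ.real B :=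
      (ENNReal.toReal_lt_toReal (measure_ne_top _ _) (measure_ne_top _ _)).2 hlt'
    linarith
  let p : A → ℕ := fun x => Nat.find (hex x)
  have hp0 : ∀ x, 0 < p x := fun x => (Nat.find_spec (hex x)).1
  have hple : ∀ x : A, S (p x + 1) x ≤ 0 := fun x => (Nat.find_spec (hex x)).2
  have hpmin : ∀ (x : A) k, 0 < k → k ≤ p x → 1 ≤ S k x := by
    intro x k hk hkp
    rcases k with _ | _ | k
    · omega
    · simp [hS1 x x.2]
    · have := Nat.find_min (hex x) (m := k + 1) (by change _ < p x; omega)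
      simp only [not_and, not_le] at this
      exact this (by omega)
  have hstep : ∀ n x, S (n + 1) x = S n x + brk A B (T^[n] x) := fun n x =>
    birkhoffSum_succ _ _ _ _
  have hbr : ∀ y, -1 ≤ brk A B y := by
    intro y
    by_cases h1 : y ∈ A <;> by_cases h2 : y ∈ B <;> simp [brk, ind, h1, h2]
  have hbB : ∀ y, brk A B y < 0 → y ∈ B := by
    intro y hy
    by_contra h2
    by_cases h1 : y ∈ A <;> simp [brk, ind, h1, h2] at hy
  have hpz : ∀ x : A, S (p x + 1) x = 0 := by
    intro x
    have h1 := hple x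
    have h2 := hpmin x (p x) (hp0 x) le_rfl
    have h3 := hstep (p x) x
    have h4 := hbr (T^[p x] x)
    omega
  have hpB : ∀ x : A, T^[p x] (x : X) ∈ B := by
    intro x
    apply hbB
    have h1 := hpz x
    have h2 := hpmin x (p x) (hp0 x) le_rfl
    have h3 := hstep (p x) x
    omega
  have hpc : IsLocallyConstant p := by
    rw [IsLocallyConstant.iff_eventually_eq]
    intro x
    have : ∀ᶠ y : A in 𝓝 x, ∀ k ∈ Finset.range (p x + 2), S k y = S k x := by
      rw [Filter.eventually_all_finset]
      intro k _
      exact (IsLocallyConstant.iff_continuous _).2 ((hSc k).comp continuous_subtype_val)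
        |>.eventually_eq x
    filter_upwards [this] with y hy
    rw [Nat.find_eq_iff]
    refine ⟨⟨hp0 x, ?_⟩, ?_⟩
    · rw [hy _ (by simp)]
      exact hple x
    · rintro n hn ⟨h0, h1⟩
      rw [hy _ (by simp; omega)] at h1
      have := hpmin x (n + 1) (by omega) (by omega)
      omega
  let φ : A → X := fun x => T^[p x] (x : X)
  have hφev : ∀ x : A, ∀ᶠ y : A in 𝓝 x, φ y = T^[p x] (y : X) := by
    intro x
    filter_upwards [hpc.eventually_eq x] with y hy
    simp only [φ, hy]
  have hφc : Continuous φ := by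
    rw [continuous_iff_continuousAt]
    intro x
    have : ContinuousAt (fun y : A => T^[p x] (y : X)) x :=
      ((hTc _).comp continuous_subtype_val).continuousAt
    exact this.congr ((hφev x).mono fun y hy => hy.symm)
  have key : ∀ x y : A, p x < p y → φ x ≠ φ y := by
    intro x y hxy h
    obtain ⟨k, hk⟩ := Nat.exists_eq_add_of_lt hxy
    have hk' : p y = p x + (k + 1) := by omega
    have hx : (x : X) = T^[k + 1] (y : X) := by
      simp only [φ, hk', Function.iterate_add_apply T (p x)] at h
      exact T.injective.iterate _ h
    have h1 := hpz y
    have h2 : S (p y + 1) y = S (k + 1) y + S (p x + 1) (T^[k + 1] y) := by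
      rw [show p y + 1 = (k + 1) + (p x + 1) by omega]
      exact birkhoffSum_add _ _ _ _ _
    rw [← hx, hpz x] at h2
    have := hpmin y (k + 1) (by omega) (by omega)
    omega
  have hφi : Function.Injective φ := by
    intro x y h
    rcases lt_trichotomy (p x) (p y) with h1 | h1 | h1
    · exact absurd h (key x y h1)
    · simp only [φ, h1] at h
      exact Subtype.ext (T.injective.iterate _ h)
    · exact absurd h.symm (key y x h1)
  have : CompactSpace A := isCompact_iff_compactSpace.1 hA.isClosed.isCompact
  have hemb : IsClosedEmbedding φ := hφc.isClosedEmbedding hφi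
  have hopen : IsOpenMap φ := by
    rw [isOpenMap_iff_nhds_le]
    intro x
    have hTo : IsOpenMap (fun y : A => T^[p x] (y : X)) := by
      have h : IsOpenMap (T^[p x]) := by
        generalize p x = n
        induction n with
        | zero => exact IsOpenMap.id
        | succ n ih => rw [Function.iterate_succ]; exact ih.comp T.isOpenMap
      exact h.comp hA.isOpen.isOpenMap_subtype_val
    have h2 := hTo.nhds_le x
    rwa [← Filter.map_congr (hφev x)] at h2
  refine ⟨range φ, ?_, ⟨hemb.isClosed_range, hopen.isOpen_range⟩, p, hpc.continuous, hp0,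
    hemb.isEmbedding.toHomeomorph, fun x => rfl⟩
  rintro _ ⟨x, rfl⟩
  exact hpB x
end

section
/- Let (X,T) be a minimal Cantor system, and let A, B be nonempty disjoint clopen subsets of X with μ(A) = μ(B) for every T-invariant Borel probability measure μ. Then there exists p : A → ℤ⁺ such that x ↦ T^{p(x)}(x) is a homeomorphism from A onto B. -/
open Set Filter Topology MeasureTheory

section Helpers

/-- Empirical measures along an orbit accumulate at an invariant measure. -/
lemma exists_inv_aux {X : Type*} [MetricSpace X] [CompactSpace X] [MeasurableSpace X]
    [BorelSpace X] (T : X → X) (hT : Continuous T) (x : X) (f : X → ℝ) (hf : Continuous f)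
    (h : ∀ n, 0 ≤ birkhoffSum T f n x) :
    ∃ μ : Measure X, IsProbabilityMeasure μ ∧ Measure.map T μ = μ ∧ 0 ≤ ∫ y, f y ∂μ := by
  have hprob : ∀ n : ℕ, IsProbabilityMeasure
      (((n : ENNReal) + 1)⁻¹ • ∑ i ∈ Finset.range (n + 1), Measure.dirac (T^[i] x)) := by
    intro n
    constructor
    simp only [Measure.smul_apply, Measure.finsetSum_apply, measure_univ, Finset.sum_const,
      Finset.card_range, smul_eq_mul, nsmul_eq_mul, mul_one]
    push_cast
    exact ENNReal.inv_mul_cancel (by simp) (by simp)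
  let ν : ℕ → ProbabilityMeasure X := fun n => ⟨_, hprob n⟩
  have hint : ∀ n (g : X → ℝ), Continuous g →
      ∫ y, g y ∂(ν n : Measure X) = birkhoffAverage ℝ T g (n + 1) x := by
    intro n g hg
    change ∫ y, g y ∂(((n : ENNReal) + 1)⁻¹ •
      ∑ i ∈ Finset.range (n + 1), Measure.dirac (T^[i] x)) = _
    rw [integral_smul_measure, integral_finsetSum_measure]
    · simp only [integral_dirac, birkhoffAverage, birkhoffSum]
      congr 1
      rw [ENNReal.toReal_inv, ENNReal.toReal_add (by simp) (by simp)]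
      simp
    · intro i _
      exact integrable_dirac (by simp)
  let F : Filter ℕ := (Filter.hyperfilter ℕ : Filter ℕ)
  have hFle : F ≤ atTop := by
    have := Filter.hyperfilter_le_cofinite (α := ℕ)
    rwa [Nat.cofinite_eq_atTop] at this
  obtain ⟨μ, -, hμ⟩ := (isCompact_univ (X := ProbabilityMeasure X)).ultrafilter_le_nhds
    ((Filter.hyperfilter ℕ).map ν) (by simp)
  have hlim : Tendsto ν F (𝓝 μ) := hμ
  have hlim' : ∀ g : X → ℝ, Continuous g →
      Tendsto (fun n => birkhoffAverage ℝ T g (n + 1) x) F (𝓝 (∫ y, g y ∂(μ : Measure X))) := by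
    intro g hg
    have := (ProbabilityMeasure.tendsto_iff_forall_integral_tendsto.1 hlim)
      (BoundedContinuousFunction.mkOfCompact ⟨g, hg⟩)
    simp only [BoundedContinuousFunction.mkOfCompact_apply, ContinuousMap.coe_mk] at this
    simpa only [hint _ g hg] using this
  refine ⟨μ, inferInstance, ?_, ?_⟩
  · have : IsProbabilityMeasure (Measure.map T (μ : Measure X)) :=
      Measure.isProbabilityMeasure_map hT.aemeasurable
    apply ext_of_forall_integral_eq_of_IsFiniteMeasure
    intro g
    rw [integral_map hT.aemeasurable g.continuous.aestronglyMeasurable]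
    have h1 := hlim' (fun y => g (T y)) (g.continuous.comp hT)
    have h2 := hlim' g g.continuous
    have h3 := (tendsto_birkhoffAverage_apply_sub_birkhoffAverage' ℝ (g := g)
      g.isBounded_range T x).comp ((tendsto_add_atTop_nat 1).mono_left hFle)
    have h4 := h1.sub h2
    have h5 : (fun n => birkhoffAverage ℝ T (fun y => g (T y)) (n + 1) x -
        birkhoffAverage ℝ T g (n + 1) x) = (fun n ↦ birkhoffAverage ℝ T g n (T x) -
          birkhoffAverage ℝ T g n x) ∘ (fun n => n + 1) := by
      funext n
      simp only [Function.comp, birkhoffAverage, birkhoffSum, ← Function.iterate_succ_apply,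
        ← Function.iterate_succ_apply']
    rw [h5] at h4
    exact sub_eq_zero.1 (tendsto_nhds_unique h4 h3)
  · refine ge_of_tendsto (hlim' f hf) (Eventually.of_forall fun n => ?_)
    simp only [birkhoffAverage, smul_eq_mul]
    exact mul_nonneg (by positivity) (h _)

/-- `U` is moved onto `V` by locally constant positive powers of `T`. -/
def Mv {X : Type*} [TopologicalSpace X] (T : X ≃ₜ X) (U V : Set X) : Prop :=
  ∃ W : ℕ → Set X, W 0 = ∅ ∧ (∀ n, IsOpen (W n)) ∧ Pairwise (fun i j => Disjoint (W i) (W j)) ∧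
    (⋃ n, W n) = U ∧ Pairwise (fun i j => Disjoint ((⇑T)^[i] '' W i) ((⇑T)^[j] '' W j)) ∧
    (⋃ n, (⇑T)^[n] '' W n) = V

lemma symm_iter_image {X : Type*} [TopologicalSpace X] (T : X ≃ₜ X) (n : ℕ) (W : Set X) :
    (⇑T.symm)^[n] '' ((⇑T)^[n] '' W) = W := by
  rw [← image_comp]
  have : (⇑T.symm)^[n] ∘ (⇑T)^[n] = id := by
    funext x
    exact Function.LeftInverse.iterate T.symm_apply_apply n x
  rw [this, image_id]

lemma isOpen_iter {X : Type*} [TopologicalSpace X] (T : X ≃ₜ X) (n : ℕ) {W : Set X}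
    (hW : IsOpen W) : IsOpen ((⇑T)^[n] '' W) := by
  induction n with
  | zero => simpa
  | succ n ih =>
    rw [Function.iterate_succ', image_comp]
    exact T.isOpenMap _ ih

lemma Mv.symm {X : Type*} [TopologicalSpace X] {T : X ≃ₜ X} {U V : Set X} (h : Mv T U V) :
    Mv T.symm V U := by
  obtain ⟨W, h0, ho, hd, hU, hd', hV⟩ := h
  refine ⟨fun n => (⇑T)^[n] '' W n, by simp [h0], fun n => isOpen_iter T n (ho n), hd', hV,
    ?_, ?_⟩
  · simpa only [symm_iter_image] using hd
  · simpa only [symm_iter_image] using hU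

lemma Mv.iUnion {X ι : Type*} [TopologicalSpace X] {T : X ≃ₜ X} {U V : ι → Set X}
    (h : ∀ i, Mv T (U i) (V i)) (hU : Pairwise (fun i j => Disjoint (U i) (U j)))
    (hV : Pairwise (fun i j => Disjoint (V i) (V j))) : Mv T (⋃ i, U i) (⋃ i, V i) := by
  choose W h0 ho hd hWU hd' hWV using h
  have hsU : ∀ k n, W k n ⊆ U k := fun k n => by
    rw [← hWU k]; exact subset_iUnion (W k) n
  have hsV : ∀ k n, (⇑T)^[n] '' W k n ⊆ V k := fun k n => by
    rw [← hWV k]; exact subset_iUnion (fun n => (⇑T)^[n] '' W k n) n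
  refine ⟨fun n => ⋃ k, W k n, by simp [h0], fun n => isOpen_iUnion fun k => ho k n, ?_, ?_, ?_, ?_⟩
  · intro i j hij
    simp only [disjoint_iUnion_left, disjoint_iUnion_right]
    intro k l
    by_cases hkl : k = l
    · subst hkl; exact hd _ hij
    · exact (hU (Ne.symm hkl)).mono (hsU _ _) (hsU _ _)
  · rw [iUnion_comm]; simp only [hWU]
  · intro i j hij
    simp only [image_iUnion, disjoint_iUnion_left, disjoint_iUnion_right]
    intro k l
    by_cases hkl : k = l
    · subst hkl; exact hd' _ hij
    · exact (hV (Ne.symm hkl)).mono (hsV _ _) (hsV _ _)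
  · simp only [image_iUnion]
    rw [iUnion_comm]; simp only [hWV]

lemma Mv.union {X : Type*} [TopologicalSpace X] {T : X ≃ₜ X} {U V U' V' : Set X}
    (h : Mv T U V) (h' : Mv T U' V') (hU : Disjoint U U') (hV : Disjoint V V') :
    Mv T (U ∪ U') (V ∪ V') := by
  rw [union_eq_iUnion, union_eq_iUnion]
  apply Mv.iUnion
  · rintro (_ | _) <;> simpa
  · rintro (_ | _) (_ | _) hne <;> simp_all [disjoint_comm]
  · rintro (_ | _) (_ | _) hne <;> simp_all [disjoint_comm]

/-- Compact sets are moved to compact sets. -/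
lemma compact_move {X : Type*} [TopologicalSpace X] {S : X → X} (hS : Continuous S)
    {W : ℕ → Set X} (ho : ∀ n, IsOpen (W n)) (hd : Pairwise (fun i j => Disjoint (W i) (W j)))
    {K : Set X} (hK : IsCompact K) (hKW : K ⊆ ⋃ n, W n) :
    IsCompact (⋃ n, S^[n] '' (K ∩ W n)) := by
  obtain ⟨t, ht⟩ := hK.elim_finite_subcover W ho hKW
  have h1 : (⋃ n, S^[n] '' (K ∩ W n)) = ⋃ n ∈ t, S^[n] '' (K ∩ W n) := by
    apply subset_antisymm
    · rintro y hy
      obtain ⟨n, x, ⟨hx, hxn⟩, rfl⟩ := mem_iUnion.1 hy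
      obtain ⟨m, hm, hxm⟩ := mem_iUnion₂.1 (ht hx)
      have : n = m := by
        by_contra hne
        exact (Set.disjoint_left.1 (hd hne)) hxn hxm
      subst this
      exact mem_iUnion₂.2 ⟨n, hm, x, ⟨hx, hxn⟩, rfl⟩
    · exact iUnion₂_subset fun n _ => subset_iUnion (fun n => S^[n] '' (K ∩ W n)) n
  rw [h1]
  refine t.isCompact_biUnion fun n _ => ?_
  refine IsCompact.image ?_ (hS.iterate n)
  have : K ∩ W n = K \ ⋃ m ∈ {m | m ≠ n}, W m := by
    ext x
    constructor
    · rintro ⟨hx, hxn⟩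
      refine ⟨hx, fun hx' => ?_⟩
      obtain ⟨m, hm, hxm⟩ := mem_iUnion₂.1 hx'
      exact (Set.disjoint_left.1 (hd hm)) hxm hxn
    · rintro ⟨hx, hx'⟩
      refine ⟨hx, ?_⟩
      obtain ⟨m, hm⟩ := mem_iUnion.1 (hKW hx)
      by_cases hmn : m = n
      · exact hmn ▸ hm
      · exact absurd (mem_iUnion₂.2 ⟨m, hmn, hm⟩) hx'
  rw [this]
  exact hK.diff (isOpen_biUnion fun m _ => ho m)

lemma Mv.isClopen {X : Type*} [TopologicalSpace X] [T2Space X] [CompactSpace X] {T : X ≃ₜ X}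
    {U V : Set X} (h : Mv T U V) (hU : IsClopen U) : IsClopen V := by
  obtain ⟨W, h0, ho, hd, hWU, hd', hV⟩ := h
  constructor
  · have := compact_move T.continuous ho hd hU.1.isCompact hWU.ge
    have h2 : ∀ n, U ∩ W n = W n := fun n => by
      rw [← hWU]; exact inter_eq_right.2 (subset_iUnion W n)
    simp only [h2, hV] at this
    exact this.isClosed
  · rw [← hV]
    exact isOpen_iUnion fun n => isOpen_iter T n (ho n)

lemma inv_iter {X : Type*} [TopologicalSpace X] [MeasurableSpace X] [BorelSpace X] (T : X ≃ₜ X)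
    {μ : Measure X} (hμ : Measure.map (⇑T) μ = μ) (n : ℕ) (W : Set X) :
    μ ((⇑T)^[n] '' W) = μ W := by
  induction n with
  | zero => simp
  | succ n ih =>
    rw [Function.iterate_succ', image_comp]
    conv_lhs => rw [← hμ]
    have := T.toMeasurableEquiv.map_apply (μ := μ) (T '' ((⇑T)^[n] '' W))
    simp only [Homeomorph.toMeasurableEquiv_coe] at this
    rw [this, preimage_image_eq _ T.injective, ih]

lemma inv_symm {X : Type*} [TopologicalSpace X] [MeasurableSpace X] [BorelSpace X] (T : X ≃ₜ X)
    {μ : Measure X} (hμ : Measure.map (⇑T) μ = μ) : Measure.map (⇑T.symm) μ = μ := by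
  conv_lhs => rw [← hμ]
  rw [Measure.map_map T.symm.continuous.measurable T.continuous.measurable]
  have : ⇑T.symm ∘ ⇑T = id := by funext x; simp
  rw [this, Measure.map_id]

lemma Mv.measure_eq {X : Type*} [TopologicalSpace X] [MeasurableSpace X] [BorelSpace X]
    {T : X ≃ₜ X} {U V : Set X} (h : Mv T U V) {μ : Measure X} (hμ : Measure.map (⇑T) μ = μ) :
    μ U = μ V := by
  obtain ⟨W, h0, ho, hd, hWU, hd', hV⟩ := h
  rw [← hWU, ← hV, measure_iUnion hd fun n => (ho n).measurableSet,
    measure_iUnion hd' fun n => (isOpen_iter T n (ho n)).measurableSet]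
  simp only [inv_iter T hμ]

/-- Comparison lemma, by matching of parentheses. -/
lemma comparison {X : Type*} [MetricSpace X] [CompactSpace X] [MeasurableSpace X] [BorelSpace X]
    (T : X ≃ₜ X) {U V : Set X} (hU : IsClopen U) (hV : IsClopen V) (hd : Disjoint U V)
    (hlt : ∀ μ : Measure X, IsProbabilityMeasure μ → Measure.map (⇑T) μ = μ → μ U < μ V) :
    ∃ V' ⊆ V, Mv T U V' := by
  classical
  let f : X → ℤ := fun x => U.indicator 1 x - V.indicator 1 x
  have hf : Continuous f := by
    refine Continuous.sub ?_ ?_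
    · exact (IsClopen.continuous_indicator hU continuous_const)
    · exact (IsClopen.continuous_indicator hV continuous_const)
  have hfU : ∀ x ∈ U, f x = 1 := fun x hx => by
    simp [f, hx, Set.disjoint_left.1 hd hx]
  have hfV : ∀ x, f x < 0 → x ∈ V := fun x hx => by
    by_contra hxV
    simp only [f, Set.indicator_of_notMem hxV, sub_zero] at hx
    have : (0 : ℤ) ≤ U.indicator 1 x := Set.indicator_nonneg (fun _ _ => by simp) x
    omega
  have hfge : ∀ x, -1 ≤ f x := fun x => by
    have h1 : (0 : ℤ) ≤ U.indicator 1 x := Set.indicator_nonneg (fun _ _ => by simp) x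
    have h2 : V.indicator 1 x ≤ (1 : ℤ) := Set.indicator_le_self' (fun _ _ => by simp) x
    simp only [f]; omega
  let S : ℕ → X → ℤ := fun n x => birkhoffSum (⇑T) f n x
  have hS : ∀ n, Continuous (S n) := fun n => by
    simp only [S, birkhoffSum]
    exact continuous_finsetSum _ fun i _ => hf.comp (T.continuous.iterate i)
  have hSsucc : ∀ n x, S (n + 1) x = S n x + f ((⇑T)^[n] x) := fun n x => birkhoffSum_succ _ _ _ _
  have hSadd : ∀ m n x, S (m + n) x = S m x + S n ((⇑T)^[m] x) := fun m n x =>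
    birkhoffSum_add _ _ _ _ _
  have hS1 : ∀ x, S 1 x = f x := fun x => birkhoffSum_one _ _ _
  have hneg : ∀ x, ∃ n, S n x < 0 := by
    intro x
    by_contra! hcon
    obtain ⟨μ, hμp, hμ, hint⟩ := exists_inv_aux (⇑T) T.continuous x (fun y => (f y : ℝ))
      (continuous_of_discreteTopology.comp hf) (fun n => by
        have := hcon n
        have h2 : birkhoffSum (⇑T) (fun y => (f y : ℝ)) n x = ((S n x : ℤ) : ℝ) := by
          simp [S, birkhoffSum]
        rw [h2]; exact_mod_cast this)
    have h3 : ∫ y, (f y : ℝ) ∂μ = μ.real U - μ.real V := by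
      have : (fun y => (f y : ℝ)) = fun y => U.indicator (1 : X → ℝ) y - V.indicator 1 y := by
        funext y
        simp only [f, Set.indicator]
        push_cast
        simp
      rw [this, integral_sub, integral_indicator_one hU.2.measurableSet,
        integral_indicator_one hV.2.measurableSet]
      · exact (integrable_const (1 : ℝ)).indicator hU.2.measurableSet
      · exact (integrable_const (1 : ℝ)).indicator hV.2.measurableSet
    have h4 : μ.real U < μ.real V :=
      (ENNReal.toReal_lt_toReal (measure_ne_top _ _) (measure_ne_top _ _)).2 (hlt μ hμp hμ)
    linarith
  let W : ℕ → Set X := fun n => {x | x ∈ U ∧ S (n + 1) x = 0 ∧ ∀ m < n, 0 < S (m + 1) x}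
  have hW0 : W 0 = ∅ := by
    ext x
    simp only [W, mem_ofPred_eq, mem_empty_iff_false, iff_false]
    rintro ⟨hx, h1, -⟩
    rw [zero_add, hS1, hfU x hx] at h1
    omega
  have hWV : ∀ n, ∀ x ∈ W n, (⇑T)^[n] x ∈ V := by
    intro n x hx
    cases n with
    | zero => rw [hW0] at hx; exact hx.elim
    | succ n =>
      apply hfV
      have h1 := hx.2.1
      have h2 := hx.2.2 n (Nat.lt_succ_self n)
      rw [hSsucc] at h1
      omega
  refine ⟨⋃ n, (⇑T)^[n] '' W n, ?_, W, hW0, ?_, ?_, ?_, ?_, rfl⟩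
  · rintro y hy
    obtain ⟨n, x, hx, rfl⟩ := mem_iUnion.1 hy
    exact hWV n x hx
  · intro n
    refine hU.2.inter (IsOpen.inter ?_ ?_)
    · exact (isOpen_discrete {(0 : ℤ)}).preimage (hS (n + 1))
    · have : {x | ∀ m < n, 0 < S (m + 1) x} = ⋂ m ∈ Finset.range n, {x | 0 < S (m + 1) x} := by
        ext x; simp
      change IsOpen {x | ∀ m < n, 0 < S (m + 1) x}
      rw [this]
      exact isOpen_biInter_finset fun m _ => isOpen_lt continuous_const (hS _)
  · have key : ∀ i j, i < j → Disjoint (W i) (W j) := by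
      intro i j hij
      rw [Set.disjoint_left]
      intro x hx hx'
      have := hx'.2.2 i hij
      have := hx.2.1
      omega
    intro i j hij
    rcases lt_or_gt_of_ne hij with h | h
    · exact key i j h
    · exact (key j i h).symm
  · ext x
    constructor
    · intro hx
      obtain ⟨n, hn⟩ := mem_iUnion.1 hx
      exact hn.1
    · intro hx
      have hex : ∃ n, S (n + 1) x ≤ 0 := by
        obtain ⟨n, hn⟩ := hneg x
        cases n with
        | zero => simp [S] at hn
        | succ n => exact ⟨n, hn.le⟩
      refine mem_iUnion.2 ⟨Nat.find hex, hx, ?_, fun m hm => not_le.1 (Nat.find_min hex hm)⟩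
      have h1 := Nat.find_spec hex
      have hmin : ∀ m < Nat.find hex, 0 < S (m + 1) x :=
        fun m hm => not_le.1 (Nat.find_min hex hm)
      generalize Nat.find hex = k at h1 hmin
      cases k with
      | zero =>
        rw [zero_add, hS1, hfU x hx] at h1
        omega
      | succ k =>
        have h2 := hmin k (Nat.lt_succ_self k)
        have h3 := hSsucc (k + 1) x
        have h4 := hfge ((⇑T)^[k + 1] x)
        omega
  · have key : ∀ i j, i < j → Disjoint ((⇑T)^[i] '' W i) ((⇑T)^[j] '' W j) := by
      intro i j hij
      rw [Set.disjoint_left]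
      rintro z ⟨y, hy, rfl⟩ ⟨x, hx, hxy⟩
      obtain ⟨d, rfl⟩ : ∃ d, j = i + (d + 1) := ⟨j - i - 1, by omega⟩
      rw [Function.iterate_add_apply] at hxy
      have hxy' := T.injective.iterate i hxy
      cases i with
      | zero => rw [hW0] at hy; exact hy.elim
      | succ i =>
        have h1 := hx.2.2 d (by omega)
        have h2 := hx.2.1
        have h3 := hy.2.1
        have h4 := hSadd (d + 1) (i + 1 + 1) x
        rw [hxy', h3] at h4
        have h5 : i + 1 + (d + 1) + 1 = d + 1 + (i + 1 + 1) := by ring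
        rw [h5] at h2
        omega
    intro i j hij
    rcases lt_or_gt_of_ne hij with h | h
    · exact key i j h
    · exact (key j i h).symm

lemma IsMinimal.symm' {X : Type*} [TopologicalSpace X] {T : X ≃ₜ X} (h : IsMinimal T) :
    IsMinimal T.symm := by
  intro x
  refine (h x).mono ?_
  rintro y ⟨n, rfl⟩
  refine ⟨-n, ?_⟩
  have : T.symm.toEquiv = (T.toEquiv)⁻¹ := rfl
  simp [this]

lemma continuous_zpow_aux {X : Type*} [TopologicalSpace X] (T : X ≃ₜ X) (k : ℤ) :
    Continuous (fun x => (T.toEquiv ^ k) x) := by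
  obtain ⟨n, rfl | rfl⟩ := k.eq_nat_or_neg
  · have : (fun x => (T.toEquiv ^ (n : ℤ)) x) = (⇑T)^[n] := by
      rw [zpow_natCast, ← Equiv.Perm.iterate_eq_pow]; rfl
    rw [this]
    exact T.continuous.iterate n
  · have : (fun x => (T.toEquiv ^ (-(n : ℤ))) x) = (⇑T.symm)^[n] := by
      rw [zpow_neg, zpow_natCast, ← inv_pow, ← Equiv.Perm.iterate_eq_pow]; rfl
    rw [this]
    exact T.symm.continuous.iterate n

lemma IsMinimal.forward {X : Type*} [TopologicalSpace X] [CompactSpace X] {T : X ≃ₜ X}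
    (h : IsMinimal T) (x : X) {O : Set X} (hO : IsOpen O) (hne : O.Nonempty) :
    ∃ n : ℕ, 0 < n ∧ (⇑T)^[n] x ∈ O := by
  obtain ⟨z, -, hz⟩ := (isCompact_univ (X := X)).exists_mapClusterPt
    (f := (atTop : Filter ℕ)) (u := fun n => (⇑T)^[n] x) (by simp)
  obtain ⟨_, hy, k, rfl⟩ := (h z).inter_open_nonempty O hO hne
  have hfr := hz.frequently ((hO.preimage (continuous_zpow_aux T k)).mem_nhds hy)
  obtain ⟨n, hn, hn'⟩ := (hfr.and_eventually (eventually_gt_atTop k.natAbs)).exists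
  obtain ⟨m, hm⟩ : ∃ m : ℕ, (m : ℤ) = k + n := ⟨(k + n).toNat, by omega⟩
  refine ⟨m, by omega, ?_⟩
  have e1 : ∀ j : ℕ, ∀ y, (⇑T)^[j] y = (T.toEquiv ^ (j : ℤ)) y := by
    intro j y
    rw [zpow_natCast, ← Equiv.Perm.iterate_eq_pow]; rfl
  rw [e1, hm, zpow_add, Equiv.Perm.mul_apply, ← e1]
  exact hn

lemma inv_iter_pre {X : Type*} [TopologicalSpace X] [MeasurableSpace X] [BorelSpace X]
    (T : X ≃ₜ X) {μ : Measure X} (hμ : Measure.map (⇑T) μ = μ) (n : ℕ) (W : Set X) :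
    μ ((⇑T)^[n] ⁻¹' W) = μ W := by
  rw [← inv_iter T hμ n, image_preimage_eq _ (T.surjective.iterate n)]

lemma IsMinimal.pos {X : Type*} [TopologicalSpace X] [CompactSpace X] [MeasurableSpace X]
    [BorelSpace X] {T : X ≃ₜ X} (h : IsMinimal T) {μ : Measure X} [IsProbabilityMeasure μ]
    (hμ : Measure.map (⇑T) μ = μ) {O : Set X} (hO : IsOpen O) (hne : O.Nonempty) : 0 < μ O := by
  rw [pos_iff_ne_zero]
  intro h0
  have h1 : (⋃ n : ℕ, (⇑T)^[n] ⁻¹' O) = univ := by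
    refine eq_univ_of_forall fun x => ?_
    obtain ⟨n, -, hn⟩ := h.forward x hO hne
    exact mem_iUnion.2 ⟨n, hn⟩
  have h2 : μ (⋃ n : ℕ, (⇑T)^[n] ⁻¹' O) = 0 :=
    measure_iUnion_null fun n => by rw [inv_iter_pre T hμ, h0]
  rw [h1, measure_univ] at h2
  exact one_ne_zero h2

/-- A pair of clopen sets with marked points and equal measures. -/
def Good {X : Type*} [TopologicalSpace X] [MeasurableSpace X] (T : X ≃ₜ X) (x y : X)
    (U V : Set X) : Prop :=
  IsClopen U ∧ IsClopen V ∧ Disjoint U V ∧ x ∈ U ∧ y ∈ V ∧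
    ∀ μ : Measure X, IsProbabilityMeasure μ → Measure.map (⇑T) μ = μ → μ U = μ V

lemma Good.symm {X : Type*} [TopologicalSpace X] [MeasurableSpace X] [BorelSpace X]
    {T : X ≃ₜ X} {x y : X} {U V : Set X} (h : Good T x y U V) : Good T.symm y x V U := by
  obtain ⟨h1, h2, h3, h4, h5, h6⟩ := h
  exact ⟨h2, h1, h3.symm, h5, h4, fun μ hp hμ => (h6 μ hp (inv_symm T.symm hμ)).symm⟩

lemma half_step {X : Type*} [MetricSpace X] [CompactSpace X] [PerfectSpace X]
    [TotallyDisconnectedSpace X] [MeasurableSpace X] [BorelSpace X]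
    {T : X ≃ₜ X} (hmin : IsMinimal T) {x y : X} {U V : Set X} (h : Good T x y U V)
    {O : Set X} (hO : IsOpen O) (hxO : x ∈ O) :
    ∃ U' V', U' ⊆ U ∧ U' ⊆ O ∧ V' ⊆ V ∧ Good T x y U' V' ∧ Mv T (U \ U') (V \ V') := by
  obtain ⟨hU, hV, hd, hx, hy, heq⟩ := h
  obtain ⟨U', hU', hxU', hsub⟩ := compact_exists_isClopen_in_isOpen (hU.2.inter hO)
    (show x ∈ U ∩ O from ⟨hx, hxO⟩)
  have hU'U : U' ⊆ U := fun z hz => (hsub hz).1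
  obtain ⟨b, hbU, hbx⟩ : ∃ b ∈ U', b ≠ x := by
    have := (hU'.2.mem_nhds hxU')
    have h2 : U' ∩ {x}ᶜ ∈ 𝓝[≠] x := inter_mem (mem_nhdsWithin_of_mem_nhds this) self_mem_nhdsWithin
    obtain ⟨b, hb⟩ := Filter.nonempty_of_mem h2
    exact ⟨b, hb.1, hb.2⟩
  obtain ⟨P, Q, hP, hQ, hxP, hbQ, hPQ⟩ := t2_separation hbx.symm
  obtain ⟨i, -, hi⟩ := hmin.forward y (hP.inter hU'.2) ⟨x, hxP, hxU'⟩
  obtain ⟨j, -, hj⟩ := hmin.forward y (hQ.inter hU'.2) ⟨b, hbQ, hbU⟩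
  obtain ⟨V₀, hV₀, hyV₀, hsub₀⟩ := compact_exists_isClopen_in_isOpen
    ((hV.2.inter ((hP.inter hU'.2).preimage (T.continuous.iterate i))).inter
      ((hQ.inter hU'.2).preimage (T.continuous.iterate j)))
    (show y ∈ _ from ⟨⟨hy, hi⟩, hj⟩)
  have hV₀V : V₀ ⊆ V := fun z hz => (hsub₀ hz).1.1
  have hsmall : ∀ μ : Measure X, IsProbabilityMeasure μ → Measure.map (⇑T) μ = μ →
      μ V₀ < μ U' := by
    intro μ hp hμ
    have h1 : μ V₀ ≤ μ (P ∩ U') := by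
      rw [← inv_iter_pre T hμ i (P ∩ U')]
      exact measure_mono fun z hz => (hsub₀ hz).1.2
    have h2 : μ V₀ ≤ μ (Q ∩ U') := by
      rw [← inv_iter_pre T hμ j (Q ∩ U')]
      exact measure_mono fun z hz => (hsub₀ hz).2
    have h3 : 0 < μ V₀ := hmin.pos hμ hV₀.2 ⟨y, hyV₀⟩
    have h4 : μ (P ∩ U') + μ (Q ∩ U') ≤ μ U' := by
      rw [← measure_union (hPQ.mono inter_subset_left inter_subset_left)
        (hQ.inter hU'.2).measurableSet]
      exact measure_mono (union_subset inter_subset_right inter_subset_right)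
    calc μ V₀ < μ V₀ + μ V₀ := ENNReal.lt_add_right (measure_ne_top _ _) h3.ne'
      _ ≤ _ := add_le_add h1 h2
      _ ≤ _ := h4
  have hUm := hU'.2.measurableSet
  obtain ⟨V₁, hV₁, hMv⟩ := comparison T (hU.diff hU') (hV.diff hV₀)
    (hd.mono sdiff_subset sdiff_subset) (by
      intro μ hp hμ
      rw [measure_sdiff hU'U hUm.nullMeasurableSet (measure_ne_top _ _),
        measure_sdiff hV₀V hV₀.2.measurableSet.nullMeasurableSet (measure_ne_top _ _), heq μ hp hμ]
      have h1 : μ U' ≤ μ V := by rw [← heq μ hp hμ]; exact measure_mono hU'U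
      have h2 := hsmall μ hp hμ
      have h3 : μ V₀ < μ V := h2.trans_le h1
      rw [ENNReal.sub_lt_iff_lt_right (measure_ne_top _ _) h1]
      calc μ V = μ V - μ V₀ + μ V₀ := (tsub_add_cancel_of_le h3.le).symm
        _ < _ := ENNReal.add_lt_add_left (ENNReal.sub_ne_top (measure_ne_top _ _)) h2)
  have hcl := hMv.isClopen (hU.diff hU')
  have hV₁V : V₁ ⊆ V := hV₁.trans sdiff_subset
  have hdd : V \ (V \ V₁) = V₁ := sdiff_sdiff_cancel_left hV₁V
  refine ⟨U', V \ V₁, hU'U, fun z hz => (hsub hz).2, sdiff_subset, ⟨hU', hV.diff hcl,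
    hd.mono hU'U sdiff_subset, hxU', ⟨hy, fun hy' => (hV₁ hy').2 hyV₀⟩, ?_⟩, by rwa [hdd]⟩
  intro μ hp hμ
  have h1 := hMv.measure_eq hμ
  rw [measure_sdiff hV₁V hcl.2.measurableSet.nullMeasurableSet (measure_ne_top _ _), ← h1,
    ← heq μ hp hμ, ← measure_sdiff sdiff_subset (hU.2.measurableSet.diff hUm).nullMeasurableSet
      (measure_ne_top _ _), sdiff_sdiff_cancel_left hU'U]

lemma full_step {X : Type*} [MetricSpace X] [CompactSpace X] [PerfectSpace X]
    [TotallyDisconnectedSpace X] [MeasurableSpace X] [BorelSpace X]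
    {T : X ≃ₜ X} (hmin : IsMinimal T) {x y : X} {U V : Set X} (h : Good T x y U V)
    {ε : ℝ} (hε : 0 < ε) :
    ∃ U' V', U' ⊆ U ∧ V' ⊆ V ∧ U' ⊆ Metric.ball x ε ∧ V' ⊆ Metric.ball y ε ∧
      Good T x y U' V' ∧ Mv T (U \ U') (V \ V') := by
  obtain ⟨U₁, V₁, hU₁, hUb, hV₁, hg, hm⟩ := half_step hmin h Metric.isOpen_ball
    (Metric.mem_ball_self hε)
  obtain ⟨V₂, U₂, hV₂, hVb, hU₂, hg₂, hm₂⟩ := half_step hmin.symm' hg.symm Metric.isOpen_ball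
    (Metric.mem_ball_self hε)
  refine ⟨U₂, V₂, hU₂.trans hU₁, hV₂.trans hV₁, hU₂.trans hUb, hVb, hg₂.symm, ?_⟩
  have := hm.union hm₂.symm (Set.disjoint_left.2 fun z hz hz' => hz.2 hz'.1)
    (Set.disjoint_left.2 fun z hz hz' => hz.2 hz'.1)
  rwa [sdiff_union_sdiff_cancel hU₁ hU₂, sdiff_union_sdiff_cancel hV₁ hV₂] at this

lemma seq_aux {X : Type*} [MetricSpace X] {x : X} (U : ℕ → Set X) (hx : ∀ n, x ∈ U n)
    (hs : ∀ n, U (n + 1) ⊆ U n) (hb : ∀ n : ℕ, U (n + 1) ⊆ Metric.ball x (1 / ((n : ℝ) + 1))) :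
    (⋃ n, U n \ U (n + 1)) = U 0 \ {x} ∧
      Pairwise (fun i j => Disjoint (U i \ U (i + 1)) (U j \ U (j + 1))) := by
  classical
  have hanti : Antitone U := antitone_nat_of_succ_le hs
  constructor
  · ext z
    constructor
    · intro hz
      obtain ⟨n, hn, hn'⟩ := mem_iUnion.1 hz
      exact ⟨hanti (Nat.zero_le n) hn, fun h => hn' (by rw [mem_singleton_iff.1 h]; exact hx _)⟩
    · rintro ⟨hz, hzx⟩
      have hex : ∃ n, z ∉ U (n + 1) := by
        have : 0 < dist z x := dist_pos.2 hzx
        obtain ⟨n, hn⟩ := exists_nat_one_div_lt this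
        exact ⟨n, fun h => absurd (Metric.mem_ball.1 (hb n h)) (not_lt.2 hn.le)⟩
      refine mem_iUnion.2 ⟨Nat.find hex, ?_, Nat.find_spec hex⟩
      have hm : ∀ m < Nat.find hex, z ∈ U (m + 1) := fun m hm => not_not.1 (Nat.find_min hex hm)
      generalize Nat.find hex = k at hm
      cases k with
      | zero => exact hz
      | succ k => exact hm k (Nat.lt_succ_self k)
  · have key : ∀ i j, i < j → Disjoint (U i \ U (i + 1)) (U j \ U (j + 1)) := fun i j hij =>
      Set.disjoint_left.2 fun z hz hz' => hz.2 (hanti (Nat.succ_le_of_lt hij) hz'.1)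
    intro i j hij
    rcases lt_or_gt_of_ne hij with h | h
    · exact key i j h
    · exact (key j i h).symm

lemma punctured {X : Type*} [MetricSpace X] [CompactSpace X] [PerfectSpace X]
    [TotallyDisconnectedSpace X] [MeasurableSpace X] [BorelSpace X]
    {T : X ≃ₜ X} (hmin : IsMinimal T) {x y : X} {U V : Set X} (h : Good T x y U V) :
    Mv T (U \ {x}) (V \ {y}) := by
  have hstep : ∀ (n : ℕ) (s : {s : Set X × Set X // Good T x y s.1 s.2}),
      ∃ s' : {s : Set X × Set X // Good T x y s.1 s.2},
        s'.1.1 ⊆ s.1.1 ∧ s'.1.2 ⊆ s.1.2 ∧ s'.1.1 ⊆ Metric.ball x (1 / ((n : ℝ) + 1)) ∧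
        s'.1.2 ⊆ Metric.ball y (1 / ((n : ℝ) + 1)) ∧
        Mv T (s.1.1 \ s'.1.1) (s.1.2 \ s'.1.2) := by
    intro n s
    obtain ⟨U', V', h1, h2, h3, h4, h5, h6⟩ := full_step hmin s.2
      (ε := 1 / ((n : ℝ) + 1)) (by positivity)
    exact ⟨⟨(U', V'), h5⟩, h1, h2, h3, h4, h6⟩
  choose next hn1 hn2 hn3 hn4 hn5 using hstep
  let s : ℕ → {s : Set X × Set X // Good T x y s.1 s.2} :=
    fun n => Nat.rec ⟨(U, V), h⟩ (fun n s => next n s) n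
  obtain ⟨hU, hUd⟩ := seq_aux (x := x) (fun n => (s n).1.1) (fun n => (s n).2.2.2.2.1)
    (fun n => hn1 n (s n)) (fun n => hn3 n (s n))
  obtain ⟨hV, hVd⟩ := seq_aux (x := y) (fun n => (s n).1.2) (fun n => (s n).2.2.2.2.2.1)
    (fun n => hn2 n (s n)) (fun n => hn4 n (s n))
  have := Mv.iUnion (fun n => hn5 n (s n)) hUd hVd
  change Mv T (⋃ n, (s n).1.1 \ (s (n + 1)).1.1) (⋃ n, (s n).1.2 \ (s (n + 1)).1.2) at this
  rw [hU, hV] at this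
  exact this

end Helpers

theorem stmt15 {X : Type*} [MetricSpace X] [CompactSpace X] [PerfectSpace X]
    [TotallyDisconnectedSpace X] [MeasurableSpace X] [BorelSpace X]
    (T : X ≃ₜ X) (hmin : IsMinimal T)
    (A B : Set X) (hA : IsClopen A) (hB : IsClopen B)
    (hAne : A.Nonempty) (hBne : B.Nonempty) (hdisj : Disjoint A B)
    (heq : ∀ μ : Measure X, IsProbabilityMeasure μ → Measure.map (⇑T) μ = μ →
      μ A = μ B) :
    ∃ p : A → ℕ, (∀ x, 0 < p x) ∧
      ∃ e : A ≃ₜ B, ∀ x : A, (e x : X) = (⇑T)^[p x] (x : X) := by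
  classical
  obtain ⟨x₀, hx₀⟩ := hAne
  obtain ⟨m, hm, hmB⟩ := hmin.forward x₀ hB.2 hBne
  obtain ⟨W, h0, ho, hd, hWU, hd', hWV⟩ :=
    punctured hmin (x := x₀) (y := (⇑T)^[m] x₀) ⟨hA, hB, hdisj, hx₀, hmB, heq⟩
  have hW : ∀ x ∈ A, x ≠ x₀ → ∃ n, x ∈ W n := fun x hx hne => by
    have : x ∈ ⋃ n, W n := by rw [hWU]; exact ⟨hx, hne⟩
    exact mem_iUnion.1 this
  have hWA : ∀ n, ∀ x ∈ W n, x ∈ A ∧ x ≠ x₀ := fun n x hx => by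
    have : x ∈ ⋃ n, W n := mem_iUnion.2 ⟨n, hx⟩
    rw [hWU] at this; exact this
  have hWB : ∀ n, ∀ x ∈ W n, (⇑T)^[n] x ∈ B ∧ (⇑T)^[n] x ≠ (⇑T)^[m] x₀ := fun n x hx => by
    have : (⇑T)^[n] x ∈ ⋃ n, (⇑T)^[n] '' W n := mem_iUnion.2 ⟨n, x, hx, rfl⟩
    rw [hWV] at this; exact this
  have hWuniq : ∀ {n k : ℕ} {x : X}, x ∈ W n → x ∈ W k → n = k := fun {n k x} h1 h2 => by
    by_contra hne
    exact Set.disjoint_left.1 (hd hne) h1 h2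
  let q : X → ℕ := fun x => if h : ∃ n, x ∈ W n then h.choose else m
  have hq : ∀ n, ∀ x ∈ W n, q x = n := fun n x hx => by
    have h : ∃ n, x ∈ W n := ⟨n, hx⟩
    simp only [q, dif_pos h]
    exact hWuniq h.choose_spec hx
  have hq0 : q x₀ = m := by
    have h : ¬ ∃ n, x₀ ∈ W n := fun ⟨n, hn⟩ => (hWA n x₀ hn).2 rfl
    simp only [q, dif_neg h]
  let F : X → X := fun x => (⇑T)^[q x] x
  have hF : ∀ n, ∀ x ∈ W n, F x = (⇑T)^[n] x := fun n x hx => by simp only [F, hq n x hx]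
  have hF0 : F x₀ = (⇑T)^[m] x₀ := by simp only [F, hq0]
  have hpos : ∀ x ∈ A, 0 < q x := fun x hx => by
    by_cases hxx : x = x₀
    · rw [hxx, hq0]; exact hm
    · obtain ⟨n, hn⟩ := hW x hx hxx
      rw [hq n x hn]
      rcases Nat.eq_zero_or_pos n with rfl | h
      · rw [h0] at hn; exact hn.elim
      · exact h
  have hmaps : ∀ x ∈ A, F x ∈ B := fun x hx => by
    by_cases hxx : x = x₀
    · rw [hxx, hF0]; exact hmB
    · obtain ⟨n, hn⟩ := hW x hx hxx
      rw [hF n x hn]; exact (hWB n x hn).1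
  have hinj : ∀ x ∈ A, ∀ y ∈ A, F x = F y → x = y := by
    intro x hx y hy hxy
    by_cases hxx : x = x₀
    · by_cases hyx : y = x₀
      · rw [hxx, hyx]
      · obtain ⟨n, hn⟩ := hW y hy hyx
        rw [hxx, hF0, hF n y hn] at hxy
        exact absurd hxy.symm (hWB n y hn).2
    · obtain ⟨k, hk⟩ := hW x hx hxx
      by_cases hyx : y = x₀
      · rw [hyx, hF0, hF k x hk] at hxy
        exact absurd hxy (hWB k x hk).2
      · obtain ⟨n, hn⟩ := hW y hy hyx
        rw [hF k x hk, hF n y hn] at hxy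
        have hkn : k = n := by
          by_contra hne
          exact Set.disjoint_left.1 (hd' hne) ⟨x, hk, rfl⟩ ⟨y, hn, hxy.symm⟩
        subst hkn
        exact T.injective.iterate k hxy
  have hsurj : ∀ y ∈ B, ∃ x ∈ A, F x = y := by
    intro y hy
    by_cases hyy : y = (⇑T)^[m] x₀
    · exact ⟨x₀, hx₀, by rw [hF0, hyy]⟩
    · have : y ∈ ⋃ n, (⇑T)^[n] '' W n := by rw [hWV]; exact ⟨hy, hyy⟩
      obtain ⟨n, x, hx, rfl⟩ := mem_iUnion.1 this
      exact ⟨x, (hWA n x hx).1, hF n x hx⟩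
  have hcont : ContinuousOn F A := by
    intro x hx
    by_cases hxx : x = x₀
    · subst hxx
      rw [ContinuousWithinAt, hF0]
      refine tendsto_nhds.2 fun O hO hmO => ?_
      have hK : IsCompact (B \ O) := hB.1.isCompact.diff hO
      have hL := compact_move T.symm.continuous (W := fun n => (⇑T)^[n] '' W n)
        (fun n => isOpen_iter T n (ho n)) hd' hK (by
          rw [hWV]
          rintro z ⟨hz, hzO⟩
          refine ⟨hz, fun h => hzO ?_⟩
          rw [mem_singleton_iff.1 h]; exact hmO)
      set L := ⋃ n, (⇑T.symm)^[n] '' ((B \ O) ∩ (⇑T)^[n] '' W n) with hLdef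
      have hxL : x ∈ Lᶜ := by
        intro hxL
        obtain ⟨n, hn⟩ := mem_iUnion.1 hxL
        have h2 := image_mono (f := (⇑T.symm)^[n]) inter_subset_right hn
        rw [symm_iter_image] at h2
        exact (hWA n x h2).2 rfl
      filter_upwards [mem_nhdsWithin_of_mem_nhds (hL.isClosed.isOpen_compl.mem_nhds hxL),
        self_mem_nhdsWithin] with z hzL hzA
      change F z ∈ O
      by_cases hzx : z = x
      · rw [hzx, hF0]; exact hmO
      · obtain ⟨n, hn⟩ := hW z hzA hzx
        by_contra hcon
        rw [hF n z hn] at hcon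
        refine hzL (mem_iUnion.2 ⟨n, (⇑T)^[n] z, ⟨⟨(hWB n z hn).1, hcon⟩, z, hn, rfl⟩, ?_⟩)
        exact Function.LeftInverse.iterate T.symm_apply_apply n z
    · obtain ⟨n, hn⟩ := hW x hx hxx
      apply ContinuousAt.continuousWithinAt
      refine (T.continuous.iterate n).continuousAt.congr ?_
      filter_upwards [(ho n).mem_nhds hn] with z hz
      exact (hF n z hz).symm
  let G : A → B := fun x => ⟨F x, hmaps x x.2⟩
  have hGb : Function.Bijective G := by
    constructor
    · intro x y hxy
      exact Subtype.ext (hinj x x.2 y y.2 (congrArg Subtype.val hxy))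
    · intro y
      obtain ⟨x, hx, hxy⟩ := hsurj y y.2
      exact ⟨⟨x, hx⟩, Subtype.ext hxy⟩
  have hGc : Continuous G := (continuousOn_iff_continuous_domRestrict.1 hcont).subtype_mk _
  have : CompactSpace A := isCompact_iff_compactSpace.1 hA.1.isCompact
  let e : A ≃ₜ B := Continuous.homeoOfEquivCompactToT2 (f := Equiv.ofBijective G hGb) hGc
  exact ⟨fun x => q x, fun x => hpos x x.2, e, fun x => rfl⟩
end
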